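/- arXiv:1204.0563 — 5 statements merged into one kernel-verified Lean document; each statement's English description precedes it below -/
import Mathlib

section
/- Let H be a real Hilbert space, let W and W_m be positive self-adjoint bounded linear operators on H with operator norms ‖W‖ ≤ κ² and ‖W_m‖ ≤ κ² for some κ > 0, and let λ > 0. Then the operator norm satisfies ‖(W_m + λI)^{-2} W_m − (W + λI)^{-2} W‖ ≤ (λ² + κ⁴)/λ⁴ · ‖W_m − W‖. -/
/-- A positive operator shifted by `c > 0` is bounded below by `c`. -/
theorem ContinuousLinearMap.IsPositive.mul_sq_norm_le_inner_add_smul_one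
    {H : Type*} [NormedAddCommGroup H] [InnerProductSpace ℝ H]
    {T : H →L[ℝ] H} (hT : T.IsPositive) (c : ℝ) (x : H) :
    c * ‖x‖ ^ 2 ≤ inner ℝ ((T + c • (1 : H →L[ℝ] H)) x) x := by
  have h : 0 ≤ inner ℝ (T x) x := hT.inner_nonneg_left x
  simpa [inner_add_left, real_inner_smul_left] using h

theorem ContinuousLinearMap.IsPositive.isUnit_add_smul_one
    {H : Type*} [NormedAddCommGroup H] [InnerProductSpace ℝ H] [CompleteSpace H]
    {T : H →L[ℝ] H} (hT : T.IsPositive) {c : ℝ} (hc : 0 < c) :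
    IsUnit (T + c • (1 : H →L[ℝ] H)) := by
  refine ContinuousLinearMap.isUnit_of_forall_le_norm_inner_map _ (c := c.toNNReal)
    (by simpa using hc) fun x => ?_
  rw [Real.coe_toNNReal c hc.le, mul_comm]
  exact (hT.mul_sq_norm_le_inner_add_smul_one c x).trans (Real.le_norm_self _)

theorem ContinuousLinearMap.IsPositive.norm_inverse_add_smul_one_le
    {H : Type*} [NormedAddCommGroup H] [InnerProductSpace ℝ H] [CompleteSpace H]
    {T : H →L[ℝ] H} (hT : T.IsPositive) {c : ℝ} (hc : 0 < c) :
    ‖Ring.inverse (T + c • (1 : H →L[ℝ] H))‖ ≤ c⁻¹ := by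
  refine ContinuousLinearMap.opNorm_le_bound _ (inv_nonneg.2 hc.le) fun y => ?_
  set R := Ring.inverse (T + c • (1 : H →L[ℝ] H)) with hR
  have hy : (T + c • (1 : H →L[ℝ] H)) (R y) = y :=
    congrArg (fun S : H →L[ℝ] H => S y) (Ring.mul_inverse_cancel _ (hT.isUnit_add_smul_one hc))
  have h := hT.mul_sq_norm_le_inner_add_smul_one c (R y)
  rw [hy] at h
  have h' := h.trans (real_inner_le_norm y (R y))
  rw [inv_mul_eq_div, le_div_iff₀' hc]
  rcases (norm_nonneg (R y)).eq_or_lt with h0 | h0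
  · rw [← h0, mul_zero]
    exact norm_nonneg y
  · exact le_of_mul_le_mul_right (by linarith) h0

/-- A resolvent-type identity for the difference of `(S + c)⁻² S` and `(T + c)⁻² T`. -/
theorem sq_inverse_mul_sub_sq_inverse_mul
    {R : Type*} [Ring R] [Algebra ℝ R] {S T : R} {c : ℝ}
    (hS : IsUnit (S + c • (1 : R))) (hT : IsUnit (T + c • (1 : R))) :
    Ring.inverse (S + c • (1 : R)) ^ 2 * S - Ring.inverse (T + c • (1 : R)) ^ 2 * T
      = Ring.inverse (S + c • (1 : R)) ^ 2 * (c ^ 2 • (S - T) - S * (S - T) * T)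
        * Ring.inverse (T + c • (1 : R)) ^ 2 := by
  have hcomm : Commute (Ring.inverse (T + c • (1 : R))) T := by
    have h : Commute (T + c • (1 : R)) T :=
      (Commute.refl T).add_left ((Commute.one_left T).smul_left c)
    obtain ⟨u, hu⟩ := hT
    rw [← hu] at h ⊢
    rw [Ring.inverse_unit]
    exact h.units_inv_left
  have key : c ^ 2 • (S - T) - S * (S - T) * T
      = S * (T + c • (1 : R)) ^ 2 - (S + c • (1 : R)) ^ 2 * T := by
    simp only [pow_two, add_mul, mul_add, mul_sub, sub_mul, smul_mul_assoc, mul_smul_comm,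
      one_mul, mul_one, smul_sub, smul_add, smul_smul, mul_assoc]
    abel
  have h1 : Ring.inverse (S + c • (1 : R)) ^ 2 * (S + c • (1 : R)) ^ 2 = 1 := by
    rw [Ring.inverse_pow, Ring.inverse_mul_cancel _ (hS.pow 2)]
  have h2 : (T + c • (1 : R)) ^ 2 * Ring.inverse (T + c • (1 : R)) ^ 2 = 1 := by
    rw [Ring.inverse_pow, Ring.mul_inverse_cancel _ (hT.pow 2)]
  rw [key, mul_sub, sub_mul, ← mul_assoc _ S, mul_assoc _ _ (Ring.inverse _ ^ 2), h2, mul_one,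
    ← mul_assoc _ _ T, h1, one_mul, (hcomm.pow_left 2).eq]


/-- For positive self-adjoint bounded operators `W, W_m` with
`‖W‖ ≤ κ²`, `‖W_m‖ ≤ κ²` and `λ > 0`,
`‖(W_m + λI)⁻² W_m − (W + λI)⁻² W‖ ≤ (λ² + κ⁴)/λ⁴ · ‖W_m − W‖`. -/
theorem regularized_inverse_perturbation_bound
    {H : Type*} [NormedAddCommGroup H] [InnerProductSpace ℝ H] [CompleteSpace H]
    (W Wm : H →L[ℝ] H) (hW : W.IsPositive) (hWm : Wm.IsPositive)
    (κ : ℝ) (hκ : 0 < κ) (hWnorm : ‖W‖ ≤ κ ^ 2) (hWmnorm : ‖Wm‖ ≤ κ ^ 2)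
    (lam : ℝ) (hlam : 0 < lam) :
    ‖(Ring.inverse (Wm + lam • (1 : H →L[ℝ] H))) ^ 2 * Wm
        - (Ring.inverse (W + lam • (1 : H →L[ℝ] H))) ^ 2 * W‖
      ≤ (lam ^ 2 + κ ^ 4) / lam ^ 4 * ‖Wm - W‖ := by
  rw [sq_inverse_mul_sub_sq_inverse_mul (hWm.isUnit_add_smul_one hlam)
    (hW.isUnit_add_smul_one hlam)]
  have hsq {T : H →L[ℝ] H} (hT : T.IsPositive) :
      ‖Ring.inverse (T + lam • (1 : H →L[ℝ] H)) ^ 2‖ ≤ lam⁻¹ ^ 2 :=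
    (norm_pow_le' _ two_pos).trans
      (pow_le_pow_left₀ (norm_nonneg _) (hT.norm_inverse_add_smul_one_le hlam) 2)
  have hmid : ‖lam ^ 2 • (Wm - W) - Wm * (Wm - W) * W‖ ≤ (lam ^ 2 + κ ^ 4) * ‖Wm - W‖ :=
    calc ‖lam ^ 2 • (Wm - W) - Wm * (Wm - W) * W‖
        ≤ ‖lam ^ 2 • (Wm - W)‖ + ‖Wm * (Wm - W) * W‖ := norm_sub_le _ _
      _ ≤ lam ^ 2 * ‖Wm - W‖ + κ ^ 2 * ‖Wm - W‖ * κ ^ 2 := by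
          gcongr
          · rw [norm_smul, Real.norm_of_nonneg (by positivity)]
          · refine (norm_mul₃_le).trans ?_
            gcongr
      _ = (lam ^ 2 + κ ^ 4) * ‖Wm - W‖ := by ring
  calc _ ≤ lam⁻¹ ^ 2 * ((lam ^ 2 + κ ^ 4) * ‖Wm - W‖) * lam⁻¹ ^ 2 := by
        refine (norm_mul₃_le).trans ?_
        gcongr
        · exact hsq hWm
        · exact hsq hW
    _ = (lam ^ 2 + κ ^ 4) / lam ^ 4 * ‖Wm - W‖ := by
        field_simp
end

section
/- Let 𝒳 be a compact metric space with a Borel probability measure μ∞, let H be a real separable Hilbert space, and let Φ : 𝒳 → H be continuous with κ² := sup_{x ∈ 𝒳} ‖Φ(x)‖² < ∞. Define the covariance operator W_c := ∫_𝒳 ⟨·, Φ(x)⟩ Φ(x) dμ∞(x), and for an i.i.d. sample x₁, …, x_m drawn from μ∞ define the empirical operator W_{c,m} := (1/m) Σ_{i=1}^m ⟨·, Φ(x_i)⟩ Φ(x_i). Fix λ > 0 and define L_c^λ(x) := (1/2)⟨(W_c + λI)^{-2} W_c Φ(x), Φ(x)⟩ and L_{c,m}^λ(x) := (1/2)⟨(W_{c,m}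 + λI)^{-2} W_{c,m} Φ(x), Φ(x)⟩. Then for each x ∈ 𝒳 and each δ ∈ (0, 1], with probability at least 1 − δ over the sample, |L_{c,m}^λ(x) − L_c^λ(x)| ≤ (2√2 κ⁴ (λ² + κ⁴) / (λ⁴ √m)) · log^{1/2}(2/δ). -/
open MeasureTheory RealInnerProductSpace

/-- The rank-one operator `h ↦ ⟨h, v⟩ v` on a real inner product space. -/
noncomputable def rankOne {H : Type*} [NormedAddCommGroup H] [InnerProductSpace ℝ H]
    (v : H) : H →L[ℝ] H :=
  (innerSL ℝ v).smulRight v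

/-- The regularized energy `v ↦ (1/2)⟨(W + λI)⁻² W v, v⟩` associated to a bounded
operator `W` on a real Hilbert space and a regularization parameter `λ`. -/
noncomputable def regEnergy {H : Type*} [NormedAddCommGroup H] [InnerProductSpace ℝ H]
    (W : H →L[ℝ] H) (lam : ℝ) (v : H) : ℝ :=
  (1 / 2) * ⟪((Ring.inverse (W + lam • (1 : H →L[ℝ] H))) ^ 2 * W) v, v⟫

/-- `y ↦ cosh √y` is convex on `[0, ∞)`. -/
theorem convexOn_cosh_sqrt : ConvexOn ℝ (Set.Ici 0) fun y : ℝ => Real.cosh (Real.sqrt y) := by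
  have hsum : ∀ y ∈ Set.Ici (0 : ℝ),
      HasSum (fun k : ℕ => y ^ k / ((2 * k).factorial : ℝ)) (Real.cosh (Real.sqrt y)) := by
    intro y hy
    have h := Real.hasSum_cosh (Real.sqrt y)
    simpa only [pow_mul, Real.sq_sqrt (Set.mem_Ici.1 hy)] using h
  refine ⟨convex_Ici 0, fun x hx y hy s t hs ht hst => ?_⟩
  have hxy : s • x + t • y ∈ Set.Ici (0 : ℝ) := convex_Ici 0 hx hy hs ht hst
  refine hasSum_le (fun k => ?_) (hsum _ hxy)
    (((hsum x hx).const_smul s).add ((hsum y hy).const_smul t))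
  have h := (convexOn_pow k).2 hx hy hs ht hst
  simp only [smul_eq_mul] at h ⊢
  rw [← mul_div_assoc, ← mul_div_assoc, ← add_div]
  gcongr

section Integrability

variable {E : Type*} [NormedAddCommGroup E] {X : Type*} [MeasurableSpace X] {μ : Measure X}
  {Y : X → E} {b : ℝ}

theorem integrable_cosh_norm_add [IsFiniteMeasure μ] (hY : StronglyMeasurable Y) (hb : ∀ x, ‖Y x‖ ≤ b)
    (z : E) :
    Integrable (fun x => Real.cosh ‖Y x + z‖) μ := by
  refine Integrable.of_bound
    (Real.continuous_cosh.comp_stronglyMeasurable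
      (hY.add stronglyMeasurable_const).norm).aestronglyMeasurable (Real.cosh (b + ‖z‖))
    (Filter.Eventually.of_forall fun x => ?_)
  have h : ‖Y x + z‖ ≤ b + ‖z‖ := (norm_add_le _ _).trans (by gcongr; exact hb x)
  rw [Real.norm_of_nonneg (Real.cosh_pos _).le, Real.cosh_le_cosh, abs_of_nonneg (norm_nonneg _)]
  exact h.trans (le_abs_self _)

theorem integrable_cosh_norm_sum [IsFiniteMeasure μ] (hY : StronglyMeasurable Y) (hb : ∀ x, ‖Y x‖ ≤ b)
    (n : ℕ) :
    Integrable (fun xs : Fin n → X => Real.cosh ‖∑ i, Y (xs i)‖) (Measure.pi fun _ => μ) := by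
  have hmeas : StronglyMeasurable fun xs : Fin n → X => ∑ i, Y (xs i) :=
    Finset.stronglyMeasurable_fun_sum _ fun i _ => hY.comp_measurable (measurable_pi_apply i)
  refine Integrable.of_bound
    (Real.continuous_cosh.comp_stronglyMeasurable hmeas.norm).aestronglyMeasurable
    (Real.cosh (n * b)) (Filter.Eventually.of_forall fun xs => ?_)
  have h : ‖∑ i, Y (xs i)‖ ≤ n * b :=
    (norm_sum_le_of_le _ fun i _ => hb (xs i)).trans (by simp)
  rw [Real.norm_of_nonneg (Real.cosh_pos _).le, Real.cosh_le_cosh, abs_of_nonneg (norm_nonneg _)]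
  exact h.trans (le_abs_self _)

end Integrability

section InnerProductSpace

variable {H : Type*} [NormedAddCommGroup H] [InnerProductSpace ℝ H]

/-- On the ball of radius `b`, the function `y ↦ cosh ‖y + z‖` is dominated by an affine function
of `y` whose value at `0` is `cosh b * cosh ‖z‖`. -/
theorem exists_cosh_norm_add_le (z : H) {b : ℝ} (hb : 0 < b) :
    ∃ k : ℝ, ∀ y : H, ‖y‖ ≤ b →
      Real.cosh ‖y + z‖ ≤ Real.cosh b * Real.cosh ‖z‖ + k * ⟪z, y⟫ := by
  rcases eq_or_ne z 0 with rfl | hz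
  · refine ⟨0, fun y hy => ?_⟩
    simpa [abs_of_pos hb] using hy
  have ha : 0 < ‖z‖ := norm_pos_iff.2 hz
  refine ⟨Real.sinh b * Real.sinh ‖z‖ / (‖z‖ * b), fun y hy => ?_⟩
  set a := ‖z‖ with ha_def
  set c := ⟪z, y⟫ / (a * b) with hc
  have hab : 0 < a * b := mul_pos ha hb
  have hin : ⟪z, y⟫ = c * (a * b) := by rw [hc]; field_simp
  have hle : |⟪z, y⟫| ≤ a * b := (abs_real_inner_le_norm z y).trans (by gcongr)
  have hc1 : |c| ≤ 1 := by
    rw [hc, abs_div, abs_of_pos hab]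
    exact (div_le_one hab).2 hle
  obtain ⟨hcl, hcu⟩ := abs_le.1 hc1
  have hconv := convexOn_cosh_sqrt.2 (Set.mem_Ici.2 (sq_nonneg (b + a)))
    (Set.mem_Ici.2 (sq_nonneg (b - a))) (by linarith : 0 ≤ (1 + c) / 2)
    (by linarith : 0 ≤ (1 - c) / 2) (by ring)
  simp only [smul_eq_mul, Real.sqrt_sq_eq_abs, Real.cosh_abs, Real.cosh_add, Real.cosh_sub]
    at hconv
  have hnorm : ‖y + z‖ ≤
      Real.sqrt ((1 + c) / 2 * (b + a) ^ 2 + (1 - c) / 2 * (b - a) ^ 2) := by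
    apply Real.le_sqrt_of_sq_le
    rw [norm_add_sq_real, real_inner_comm, hin]
    nlinarith [pow_le_pow_left₀ (norm_nonneg y) hy 2]
  calc Real.cosh ‖y + z‖ ≤ _ := by
        rw [Real.cosh_le_cosh, abs_of_nonneg (norm_nonneg _), abs_of_nonneg (Real.sqrt_nonneg _)]
        exact hnorm
    _ ≤ _ := hconv
    _ = _ := by rw [hin]; field_simp; ring

section Concentration

variable [CompleteSpace H] {X : Type*} [MeasurableSpace X] {μ : Measure X} [IsProbabilityMeasure μ]
  {Y : X → H} {b : ℝ}

theorem integral_cosh_norm_add_le (hY : StronglyMeasurable Y) (hb : ∀ x, ‖Y x‖ ≤ b) (hb0 : 0 < b)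
    (hmean : ∫ x, Y x ∂μ = 0) (z : H) :
    ∫ x, Real.cosh ‖Y x + z‖ ∂μ ≤ Real.cosh b * Real.cosh ‖z‖ := by
  obtain ⟨k, hk⟩ := exists_cosh_norm_add_le z hb0
  have hint : Integrable Y μ :=
    Integrable.of_bound hY.aestronglyMeasurable b (Filter.Eventually.of_forall hb)
  have hinner : Integrable (fun x => k * ⟪z, Y x⟫) μ := (hint.const_inner z).const_mul k
  calc ∫ x, Real.cosh ‖Y x + z‖ ∂μ
      ≤ ∫ x, (Real.cosh b * Real.cosh ‖z‖ + k * ⟪z, Y x⟫) ∂μ :=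
        integral_mono (integrable_cosh_norm_add hY hb z) ((integrable_const _).add hinner)
          fun x => hk _ (hb x)
    _ = Real.cosh b * Real.cosh ‖z‖ := by
        rw [integral_add (integrable_const _) hinner, integral_const_mul k, integral_inner hint,
          hmean]
        simp

theorem integral_cosh_norm_sum_le (hY : StronglyMeasurable Y) (hb : ∀ x, ‖Y x‖ ≤ b) (hb0 : 0 < b)
    (hmean : ∫ x, Y x ∂μ = 0) (n : ℕ) :
    ∫ xs : Fin n → X, Real.cosh ‖∑ i, Y (xs i)‖ ∂(Measure.pi fun _ => μ) ≤ Real.cosh b ^ n := by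
  induction n with
  | zero => simp
  | succ n ih =>
    have hmp := (measurePreserving_piFinSuccAbove (fun _ : Fin (n + 1) => μ) 0).symm
    have heq : ∀ p : X × (Fin n → X),
        ∑ i, Y ((MeasurableEquiv.piFinSuccAbove (fun _ : Fin (n + 1) => X) 0).symm p i)
          = Y p.1 + ∑ i, Y (p.2 i) := by
      intro p
      rw [Fin.sum_univ_succ]
      rfl
    have hint := (hmp.integrable_comp_emb (MeasurableEquiv.measurableEmbedding _)).2
      (integrable_cosh_norm_sum (μ := μ) hY hb (n + 1))
    simp only [Function.comp_def, heq] at hint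
    rw [← hmp.integral_comp (MeasurableEquiv.measurableEmbedding _)]
    simp only [heq]
    rw [integral_prod_symm _ hint]
    calc _ ≤ ∫ xs : Fin n → X, Real.cosh b * Real.cosh ‖∑ i, Y (xs i)‖ ∂(Measure.pi fun _ => μ) :=
          integral_mono (f := fun xs : Fin n → X => ∫ x, Real.cosh ‖Y x + ∑ i, Y (xs i)‖ ∂μ)
            hint.integral_prod_right ((integrable_cosh_norm_sum hY hb n).const_mul _)
            fun xs => integral_cosh_norm_add_le hY hb hb0 hmean _
      _ ≤ _ := by
          rw [integral_const_mul, pow_succ']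
          exact mul_le_mul_of_nonneg_left ih (Real.cosh_pos b).le

/-- Hoeffding's inequality for i.i.d. bounded centered vectors in a Hilbert space. -/
theorem measure_norm_sum_ge_le (hY : StronglyMeasurable Y) (hb : ∀ x, ‖Y x‖ ≤ b) (hb0 : 0 < b)
    (hmean : ∫ x, Y x ∂μ = 0) {n : ℕ} (hn : 0 < n) {ε : ℝ} (hε : 0 ≤ ε) :
    (Measure.pi fun _ : Fin n => μ).real {xs | ε ≤ ‖∑ i, Y (xs i)‖}
      ≤ 2 * Real.exp (-ε ^ 2 / (2 * n * b ^ 2)) := by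
  have hn' : (0 : ℝ) < n := by exact_mod_cast hn
  set t := ε / (n * b ^ 2) with ht
  rcases hε.eq_or_lt with rfl | hε
  · simp
  have ht0 : 0 < t := by positivity
  have hscale : ∀ xs : Fin n → X, ‖∑ i, (t • Y) (xs i)‖ = t * ‖∑ i, Y (xs i)‖ := by
    intro xs
    simp only [Pi.smul_apply, ← Finset.smul_sum]
    rw [norm_smul, Real.norm_of_nonneg ht0.le]
  have hYt : StronglyMeasurable (t • Y) := hY.const_smul t
  have hbt : ∀ x, ‖(t • Y) x‖ ≤ t * b := fun x => by
    rw [Pi.smul_apply, norm_smul, Real.norm_of_nonneg ht0.le]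
    gcongr
    exact hb x
  have hmeant : ∫ x, (t • Y) x ∂μ = 0 := by simp [integral_smul, hmean]
  have hmom := integral_cosh_norm_sum_le hYt hbt (mul_pos ht0 hb0) hmeant n
  have hmarkov := mul_meas_ge_le_integral_of_nonneg (μ := Measure.pi fun _ : Fin n => μ)
    (Filter.Eventually.of_forall fun xs : Fin n → X =>
      (Real.cosh_pos ‖∑ i, (t • Y) (xs i)‖).le)
    (integrable_cosh_norm_sum hYt hbt n) (Real.cosh (t * ε))
  have hset : {xs : Fin n → X | Real.cosh (t * ε) ≤ Real.cosh ‖∑ i, (t • Y) (xs i)‖}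
      = {xs | ε ≤ ‖∑ i, Y (xs i)‖} := by
    ext xs
    simp only [Set.mem_ofPred_eq, hscale, Real.cosh_le_cosh]
    rw [abs_of_pos (by positivity), abs_of_nonneg (by positivity)]
    exact mul_le_mul_iff_right₀ ht0
  rw [hset] at hmarkov
  have hcosh : Real.cosh (t * b) ^ n ≤ Real.exp (ε ^ 2 / (2 * n * b ^ 2)) := by
    calc Real.cosh (t * b) ^ n ≤ Real.exp ((t * b) ^ 2 / 2) ^ n := by
          gcongr
          exact Real.cosh_le_exp_half_sq _
      _ = _ := by
          rw [← Real.exp_nat_mul, ht]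
          congr 1
          field_simp
  have hlow : Real.exp (ε ^ 2 / (n * b ^ 2)) / 2 ≤ Real.cosh (t * ε) := by
    have : t * ε = ε ^ 2 / (n * b ^ 2) := by rw [ht]; ring
    rw [this, Real.cosh_eq]
    linarith [Real.exp_pos (-(ε ^ 2 / (n * b ^ 2)))]
  set P := (Measure.pi fun _ : Fin n => μ).real {xs | ε ≤ ‖∑ i, Y (xs i)‖}
  have hP : 0 ≤ P := measureReal_nonneg
  have hfin : Real.exp (ε ^ 2 / (n * b ^ 2)) / 2 * P ≤ Real.exp (ε ^ 2 / (2 * n * b ^ 2)) :=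
    (mul_le_mul_of_nonneg_right hlow hP).trans (hmarkov.trans (hmom.trans hcosh))
  have hexp : Real.exp (-ε ^ 2 / (2 * n * b ^ 2)) * Real.exp (ε ^ 2 / (n * b ^ 2))
      = Real.exp (ε ^ 2 / (2 * n * b ^ 2)) := by
    rw [← Real.exp_add]
    congr 1
    field_simp
    ring
  rw [← hexp] at hfin
  have := Real.exp_pos (ε ^ 2 / (n * b ^ 2))
  nlinarith

/-- Confidence form of Hoeffding's inequality for bounded centered vectors in a Hilbert space. -/
theorem ofReal_one_sub_le_measure_norm_sum_le (hY : StronglyMeasurable Y) (hb : ∀ x, ‖Y x‖ ≤ b)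
    (hb0 : 0 < b) (hmean : ∫ x, Y x ∂μ = 0) {n : ℕ} (hn : 0 < n) {δ : ℝ}
    (hδ : δ ∈ Set.Ioc (0 : ℝ) 1) :
    ENNReal.ofReal (1 - δ) ≤ (Measure.pi fun _ : Fin n => μ)
      {xs | ‖∑ i, Y (xs i)‖ ≤ b * Real.sqrt (2 * n) * Real.sqrt (Real.log (2 / δ))} := by
  obtain ⟨hδ0, hδ1⟩ := hδ
  have hn' : (0 : ℝ) < n := by exact_mod_cast hn
  have hlog : 0 ≤ Real.log (2 / δ) := Real.log_nonneg (by rw [le_div_iff₀ hδ0]; linarith)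
  set ε := b * Real.sqrt (2 * n) * Real.sqrt (Real.log (2 / δ)) with hε
  have hε0 : 0 ≤ ε := by positivity
  have htail := measure_norm_sum_ge_le hY hb hb0 hmean hn hε0
  have hδ' : 2 * Real.exp (-ε ^ 2 / (2 * n * b ^ 2)) = δ := by
    have : -ε ^ 2 / (2 * n * b ^ 2) = -Real.log (2 / δ) := by
      rw [hε, mul_pow, mul_pow, Real.sq_sqrt (by positivity), Real.sq_sqrt hlog]
      field_simp
    rw [this, Real.exp_neg, Real.exp_log (by positivity)]
    field_simp
  rw [hδ'] at htail
  have hmeas : MeasurableSet {xs : Fin n → X | ε ≤ ‖∑ i, Y (xs i)‖} :=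
    measurableSet_le measurable_const (Finset.stronglyMeasurable_fun_sum _ fun i _ =>
      hY.comp_measurable (measurable_pi_apply i)).norm.measurable
  calc ENNReal.ofReal (1 - δ)
      ≤ ENNReal.ofReal ((Measure.pi fun _ : Fin n => μ).real
          {xs | ε ≤ ‖∑ i, Y (xs i)‖}ᶜ) := by
        rw [probReal_compl_eq_one_sub hmeas]
        gcongr
    _ = (Measure.pi fun _ : Fin n => μ) {xs | ε ≤ ‖∑ i, Y (xs i)‖}ᶜ := ofReal_measureReal
    _ ≤ _ := measure_mono fun xs hxs => by
        simp only [Set.mem_compl_iff, Set.mem_ofPred_eq, not_le] at hxs ⊢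
        exact hxs.le

end Concentration

section RegularizedEnergy

theorem rankOne_apply (v u : H) : rankOne v u = ⟪v, u⟫ • v := rfl

theorem rankOne_isPositive (v : H) : (rankOne v).IsPositive := by
  refine ⟨fun x y => ?_, fun x => ?_⟩
  · simp [rankOne_apply, real_inner_smul_right, real_inner_comm, mul_comm]
  · simp only [ContinuousLinearMap.reApplyInnerSelf_apply, rankOne_apply, real_inner_smul_left,
      RCLike.re_to_real]
    exact mul_self_nonneg _

theorem norm_rankOne_apply_le (v u : H) : ‖rankOne v u‖ ≤ ‖v‖ ^ 2 * ‖u‖ := by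
  rw [rankOne_apply, norm_smul]
  calc ‖⟪v, u⟫‖ * ‖v‖ ≤ (‖v‖ * ‖u‖) * ‖v‖ := by gcongr; exact norm_inner_le_norm v u
    _ = _ := by ring

theorem continuous_rankOne : Continuous (rankOne : H → H →L[ℝ] H) :=
  ((ContinuousLinearMap.smulRightL ℝ H H).continuous.comp
    (innerSL ℝ).continuous).clm_apply continuous_id

theorem isPositive_empirical_rankOne {ι X : Type*} [Fintype ι] (Φ : X → H) (xs : ι → X) {c : ℝ}
    (hc : 0 ≤ c) : (c • ∑ i, rankOne (Φ (xs i))).IsPositive :=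
  (ContinuousLinearMap.isPositive_sum _ fun i _ => rankOne_isPositive (Φ (xs i))).smul_of_nonneg hc

variable {W : H →L[ℝ] H} {lam : ℝ}

theorem ContinuousLinearMap.IsPositive.mul_norm_le_norm_add_smul (hW : W.IsPositive) (z : H) :
    lam * ‖z‖ ≤ ‖W z + lam • z‖ := by
  rcases eq_or_ne z 0 with rfl | hz
  · simp
  have hz : 0 < ‖z‖ := norm_pos_iff.2 hz
  have h1 : ⟪W z + lam • z, z⟫ = ⟪W z, z⟫ + lam * ‖z‖ ^ 2 := by
    rw [inner_add_left, real_inner_smul_left, real_inner_self_eq_norm_sq]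
  have h2 : 0 ≤ ⟪W z, z⟫ := hW.inner_nonneg_left z
  have h3 := real_inner_le_norm (W z + lam • z) z
  refine le_of_mul_le_mul_right ?_ hz
  nlinarith

variable [CompleteSpace H]

theorem ContinuousLinearMap.IsPositive.isUnit_add_smul (hW : W.IsPositive) (hlam : 0 < lam) :
    IsUnit (W + lam • (1 : H →L[ℝ] H)) := by
  refine ContinuousLinearMap.isUnit_of_forall_le_norm_inner_map _ (c := ⟨lam, hlam.le⟩) hlam
    fun z => ?_
  have h1 : ⟪(W + lam • (1 : H →L[ℝ] H)) z, z⟫ = ⟪W z, z⟫ + lam * ‖z‖ ^ 2 := by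
    simp [inner_add_left, real_inner_smul_left]
  have h2 : 0 ≤ ⟪W z, z⟫ := hW.inner_nonneg_left z
  rw [h1]
  refine le_trans ?_ (le_abs_self _)
  change ‖z‖ ^ 2 * lam ≤ _
  linarith

/-- The resolvent equation has a solution `r`, and the regularized energy is `(1/2)⟨W r, r⟩`. -/
theorem ContinuousLinearMap.IsPositive.exists_regEnergy_eq (hW : W.IsPositive) (hlam : 0 < lam)
    (v : H) : ∃ r : H, W r + lam • r = v ∧ regEnergy W lam v = 1 / 2 * ⟪W r, r⟫ := by
  have hu := hW.isUnit_add_smul hlam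
  set A := W + lam • (1 : H →L[ℝ] H) with hA
  set R := Ring.inverse A with hR
  have hAR : A * R = 1 := Ring.mul_inverse_cancel A hu
  have hRA : R * A = 1 := Ring.inverse_mul_cancel A hu
  have hWA : W = A - lam • (1 : H →L[ℝ] H) := by rw [hA]; abel
  have hcomm : R * W = W * R := by
    rw [hWA, mul_sub, sub_mul, hAR, hRA]; simp
  have happ : ∀ z, W (R z) + lam • R z = z := fun z => by
    simpa [hA] using congrArg (fun T : H →L[ℝ] H => T z) hAR
  have hsymm : ∀ y z, ⟪W y, z⟫ = ⟪y, W z⟫ := fun y z => hW.isSymmetric y z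
  refine ⟨R v, happ v, ?_⟩
  have hop : R ^ 2 * W = R * (W * R) := by rw [← hcomm]; noncomm_ring
  unfold regEnergy
  rw [← hA, ← hR, hop]
  congr 1
  set r := R v with hr
  change ⟪R (W r), v⟫ = _
  rw [← happ v, ← hr, inner_add_right, ← hsymm, real_inner_smul_right, ← real_inner_smul_left,
    ← inner_add_left, happ]

/-- Stability of the regularized energy: only the action of `W' - W` on the resolvent vector `r`
of `W` matters. -/
theorem exists_abs_regEnergy_sub_le (hW : W.IsPositive) (hlam : 0 < lam) (v : H) :
    ∃ r : H, lam * ‖r‖ ≤ ‖v‖ ∧ ∀ W' : H →L[ℝ] H, W'.IsPositive →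
      |regEnergy W' lam v - regEnergy W lam v| ≤ ‖v‖ * ‖W' r - W r‖ / (2 * lam) := by
  obtain ⟨r, hr, hE⟩ := hW.exists_regEnergy_eq hlam v
  refine ⟨r, hr ▸ hW.mul_norm_le_norm_add_smul r, fun W' hW' => ?_⟩
  obtain ⟨r', hr', hE'⟩ := hW'.exists_regEnergy_eq hlam v
  have hdiff : lam * ‖r' - r‖ ≤ ‖W' r - W r‖ := by
    refine (hW'.mul_norm_le_norm_add_smul (r' - r)).trans_eq ?_
    rw [← norm_neg]
    congr 1
    have : W' r' + lam • r' = W r + lam • r := hr'.trans hr.symm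
    rw [map_sub, smul_sub, eq_sub_of_add_eq this]
    abel
  -- The Cayley-type vectors `v - (2 * lam) • s = T s - lam • s` have norm at most `‖v‖`.
  have hsq : ∀ (T : H →L[ℝ] H) (s : H), T s + lam • s = v →
      ‖v - (2 * lam) • s‖ ^ 2 = ‖v‖ ^ 2 - 4 * lam * ⟪T s, s⟫ := by
    intro T s hs
    have : T s = v - lam • s := eq_sub_of_add_eq hs
    rw [norm_sub_sq_real, this, inner_sub_left, real_inner_smul_left, real_inner_smul_right,
      real_inner_self_eq_norm_sq, norm_smul, mul_pow, Real.norm_eq_abs, sq_abs]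
    ring
  have hcontr : ∀ (T : H →L[ℝ] H) (s : H), T.IsPositive → T s + lam • s = v →
      ‖v - (2 * lam) • s‖ ≤ ‖v‖ := by
    intro T s hT hs
    refine le_of_sq_le_sq ?_ (norm_nonneg _)
    rw [hsq T s hs]
    have : 0 ≤ ⟪T s, s⟫ := hT.inner_nonneg_left s
    have := mul_nonneg hlam.le this
    linarith
  have h1 := hsq W r hr
  have h2 := hsq W' r' hr'
  have c1 := hcontr W r hW hr
  have c2 := hcontr W' r' hW' hr'
  have hd : |‖v - (2 * lam) • r'‖ - ‖v - (2 * lam) • r‖| ≤ 2 * ‖W' r - W r‖ := by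
    refine (abs_norm_sub_norm_le _ _).trans ?_
    rw [sub_sub_sub_cancel_left, ← smul_sub, norm_smul, Real.norm_of_nonneg (by positivity),
      norm_sub_rev]
    linarith
  have hprod : |‖v - (2 * lam) • r'‖ ^ 2 - ‖v - (2 * lam) • r‖ ^ 2|
      ≤ (‖v‖ + ‖v‖) * (2 * ‖W' r - W r‖) := by
    rw [sq_sub_sq, abs_mul]
    refine mul_le_mul ?_ hd (abs_nonneg _) (by positivity)
    rw [abs_of_nonneg (by positivity)]
    gcongr
  rw [le_div_iff₀ (by positivity), hE, hE']
  have hexp : ‖v - (2 * lam) • r'‖ ^ 2 - ‖v - (2 * lam) • r‖ ^ 2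
      = -(8 * lam) * (1 / 2 * ⟪W' r', r'⟫ - 1 / 2 * ⟪W r, r⟫) := by
    rw [h1, h2]; ring
  rw [hexp, abs_mul, abs_neg, abs_of_pos (by positivity : 0 < 8 * lam)] at hprod
  linarith

theorem isPositive_integral {X : Type*} [MeasurableSpace X] {μ : Measure X} {T : X → H →L[ℝ] H}
    (hT : Integrable T μ) (hpos : ∀ x, (T x).IsPositive) : (∫ x, T x ∂μ).IsPositive := by
  have hint : ∀ y, Integrable (fun x => T x y) μ := fun y => hT.apply_continuousLinearMap y
  have happ : ∀ y z, ⟪(∫ x, T x ∂μ) y, z⟫ = ∫ x, ⟪T x y, z⟫ ∂μ := by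
    intro y z
    rw [ContinuousLinearMap.integral_apply hT, real_inner_comm, ← integral_inner (hint y)]
    simp only [real_inner_comm]
  refine ⟨fun y z => ?_, fun y => ?_⟩
  · change ⟪(∫ x, T x ∂μ) y, z⟫ = ⟪y, (∫ x, T x ∂μ) z⟫
    rw [happ, real_inner_comm, happ]
    refine integral_congr_ae (Filter.Eventually.of_forall fun x => ?_)
    exact ((hpos x).isSymmetric y z).trans (real_inner_comm _ _)
  · change 0 ≤ ⟪(∫ x, T x ∂μ) y, y⟫
    rw [happ]
    exact integral_nonneg fun x => (hpos x).inner_nonneg_left y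

end RegularizedEnergy

end InnerProductSpace

/-- Sample-error bound for the regularized controllability energy
estimator: for each `x ∈ 𝒳` and `δ ∈ (0,1]`, with probability at least `1 − δ` over
an i.i.d. sample `x₁,…,x_m` from `μ∞`,
`|L_{c,m}^λ(x) − L_c^λ(x)| ≤ 2√2 κ⁴(λ² + κ⁴)/(λ⁴√m) · log^{1/2}(2/δ)`. -/
theorem regularized_energy_estimator_sample_error
    {X : Type*} [MetricSpace X] [CompactSpace X] [MeasurableSpace X] [BorelSpace X]
    {H : Type*} [NormedAddCommGroup H] [InnerProductSpace ℝ H] [CompleteSpace H]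
    [SecondCountableTopology H]
    (μ : Measure X) [IsProbabilityMeasure μ]
    (Φ : X → H) (hΦ : Continuous Φ)
    (κ : ℝ) (hκ : κ ^ 2 = ⨆ x, ‖Φ x‖ ^ 2)
    (m : ℕ) (hm : 0 < m) (lam : ℝ) (hlam : 0 < lam)
    (x : X) (δ : ℝ) (hδ : δ ∈ Set.Ioc (0 : ℝ) 1) :
    ENNReal.ofReal (1 - δ) ≤
      (Measure.pi fun _ : Fin m => μ)
        {xs : Fin m → X |
          |regEnergy ((m : ℝ)⁻¹ • ∑ i, rankOne (Φ (xs i))) lam (Φ x)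
              - regEnergy (∫ x', rankOne (Φ x') ∂μ) lam (Φ x)|
            ≤ 2 * Real.sqrt 2 * κ ^ 4 * (lam ^ 2 + κ ^ 4) / (lam ^ 4 * Real.sqrt m)
                * Real.sqrt (Real.log (2 / δ))} := by
  have hm' : (0 : ℝ) < m := by exact_mod_cast hm
  have hbdd : BddAbove (Set.range fun x => ‖Φ x‖ ^ 2) :=
    (isCompact_range (hΦ.norm.pow 2)).bddAbove
  have hΦκ : ∀ y, ‖Φ y‖ ≤ |κ| := fun y =>
    le_of_sq_le_sq ((le_ciSup hbdd y).trans_eq (by rw [sq_abs, hκ])) (abs_nonneg κ)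
  have hcont : Continuous fun y => rankOne (Φ y) := continuous_rankOne.comp hΦ
  have hint : Integrable (fun y => rankOne (Φ y)) μ :=
    hcont.integrable_of_hasCompactSupport (HasCompactSupport.of_compactSpace _)
  set W := ∫ y, rankOne (Φ y) ∂μ with hW
  have hWpos : W.IsPositive := isPositive_integral hint fun y => rankOne_isPositive (Φ y)
  obtain ⟨r, hr, hstab⟩ := exists_abs_regEnergy_sub_le hWpos hlam (Φ x)
  rcases eq_or_ne κ 0 with rfl | hκ0
  · have hx : Φ x = 0 := norm_le_zero_iff.1 (by simpa using hΦκ x)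
    simp [hx, regEnergy, hδ.1.le]
  set K := |κ| with hK
  have hK0 : 0 < K := abs_pos.2 hκ0
  have hrK : ‖r‖ ≤ K / lam := by
    rw [le_div_iff₀ hlam]
    linarith [hΦκ x]
  have hone : ∀ y, ‖rankOne (Φ y) r‖ ≤ K ^ 3 / lam := fun y =>
    (norm_rankOne_apply_le _ _).trans <| by
      calc ‖Φ y‖ ^ 2 * ‖r‖ ≤ K ^ 2 * (K / lam) := by gcongr; exact hΦκ y
        _ = K ^ 3 / lam := by ring
  have hWr : W r = ∫ y, rankOne (Φ y) r ∂μ := ContinuousLinearMap.integral_apply hint r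
  have hWr_le : ‖W r‖ ≤ K ^ 3 / lam := by
    rw [hWr]
    simpa using norm_integral_le_of_norm_le_const (μ := μ) (Filter.Eventually.of_forall hone)
  have hYcont : Continuous fun y => rankOne (Φ y) r - W r :=
    (hcont.clm_apply continuous_const).sub continuous_const
  have hmean : ∫ y, (rankOne (Φ y) r - W r) ∂μ = 0 := by
    rw [integral_sub (hint.apply_continuousLinearMap r) (integrable_const _), ← hWr]
    simp
  refine (ofReal_one_sub_le_measure_norm_sum_le (b := 2 * (K ^ 3 / lam)) hYcont.stronglyMeasurable
    (fun y => (norm_sub_le _ _).trans (by linarith [hone y])) (by positivity) hmean hm hδ).trans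
    (measure_mono fun xs hxs => ?_)
  simp only [Set.mem_ofPred_eq] at hxs ⊢
  refine (hstab _ (isPositive_empirical_rankOne Φ xs (by positivity))).trans ?_
  have hdev : ((m : ℝ)⁻¹ • ∑ i, rankOne (Φ (xs i))) r - W r
      = (m : ℝ)⁻¹ • ∑ i, (rankOne (Φ (xs i)) r - W r) := by
    rw [Finset.sum_sub_distrib, smul_sub]
    simp [← Nat.cast_smul_eq_nsmul ℝ, smul_smul, hm'.ne']
  set L := Real.sqrt (Real.log (2 / δ)) with hL
  have hL0 : 0 ≤ L := Real.sqrt_nonneg _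
  have hsm : 0 < Real.sqrt m := Real.sqrt_pos.2 hm'
  rw [hdev, norm_smul, Real.norm_of_nonneg (by positivity)]
  have hκ4 : κ ^ 4 = K ^ 4 := by rw [hK, ← abs_pow, abs_of_nonneg (by positivity)]
  calc ‖Φ x‖ * ((m : ℝ)⁻¹ * ‖∑ i, (rankOne (Φ (xs i)) r - W r)‖) / (2 * lam)
      ≤ K * ((m : ℝ)⁻¹ * (2 * (K ^ 3 / lam) * Real.sqrt (2 * m) * L)) / (2 * lam) := by
        gcongr
        exact hΦκ x
    _ = Real.sqrt 2 * K ^ 4 * lam ^ 2 / (lam ^ 4 * Real.sqrt m) * L := by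
        rw [Real.sqrt_mul (by norm_num)]
        nth_rewrite 1 [← Real.sq_sqrt hm'.le]
        field_simp
    _ ≤ _ := by
        rw [hκ4]
        have h2 : 0 ≤ Real.sqrt 2 * K ^ 4 := by positivity
        gcongr ?_ / _ * _
        nlinarith [mul_nonneg h2 (sq_nonneg lam), mul_nonneg h2 (pow_nonneg hK0.le 4)]
end

section
/- Let (σ_i)_{i ∈ ℕ} be nonnegative reals and (c_i)_{i ∈ ℕ} reals such that Σ_{i : σ_i > 0} c_i²/σ_i < ∞. Then lim_{λ → 0⁺} Σ_{i} (σ_i/(σ_i + λ)²) c_i² = Σ_{i : σ_i > 0} c_i²/σ_i. -/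
/-- If `σᵢ ≥ 0` and `Σ_{i : σᵢ > 0} cᵢ²/σᵢ < ∞`, then
`lim_{λ → 0⁺} Σᵢ (σᵢ/(σᵢ + λ)²) cᵢ² = Σ_{i : σᵢ > 0} cᵢ²/σᵢ`.
(With the Lean convention `a / 0 = 0`, the term `cᵢ²/σᵢ` vanishes when `σᵢ = 0`,
so `∑' i, cᵢ²/σᵢ` is exactly the sum over `{i : σᵢ > 0}`; likewise the terms of the
left-hand sum vanish when `σᵢ = 0`.) -/
theorem regularized_energy_approximation_limit
    (σ c : ℕ → ℝ) (hσ : ∀ i, 0 ≤ σ i)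
    (hsum : Summable fun i => c i ^ 2 / σ i) :
    Filter.Tendsto (fun lam : ℝ => ∑' i, σ i / (σ i + lam) ^ 2 * c i ^ 2)
      (nhdsWithin 0 (Set.Ioi 0)) (nhds (∑' i, c i ^ 2 / σ i)) := by
  refine tendsto_tsum_of_dominated_convergence hsum (fun i => ?_) ?_
  · rcases (hσ i).eq_or_lt with h | h
    · simp [← h]
    · have hcont : ContinuousAt (fun lam : ℝ => σ i / (σ i + lam) ^ 2 * c i ^ 2) 0 :=
        (continuousAt_const.div (by fun_prop) (by simpa using h.ne')).mul continuousAt_const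
      have hzero : σ i / (σ i + 0) ^ 2 * c i ^ 2 = c i ^ 2 / σ i := by
        rw [add_zero]
        field_simp
      exact hzero ▸ hcont.tendsto.mono_left nhdsWithin_le_nhds
  · filter_upwards [self_mem_nhdsWithin] with lam hlam i
    have hlam' : 0 < lam := hlam
    have hi := hσ i
    rw [Real.norm_of_nonneg (by positivity)]
    rcases hi.eq_or_lt with h | h
    · simp [← h]
    · calc σ i / (σ i + lam) ^ 2 * c i ^ 2 ≤ σ i / σ i ^ 2 * c i ^ 2 := by
            gcongr
            linarith
        _ = c i ^ 2 / σ i := by field_simp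
end

section
/- Let (σ_i)_{i ∈ ℕ} be nonnegative reals, (c_i)_{i ∈ ℕ} reals with Σ_{i : σ_i > 0} c_i²/σ_i < ∞, and λ > 0. Then | Σ_{i} (σ_i/(σ_i + λ)²) c_i² − Σ_{i : σ_i > 0} c_i²/σ_i | ≤ λ · Σ_{i : σ_i > 0} ((2σ_i + λ)/((σ_i + λ)² σ_i)) c_i². -/
/-- The termwise identity behind the error bound; it also holds at `s = 0`, as `a / 0 = 0`. -/
theorem regularization_filter_identity {s lam : ℝ} (hs : 0 ≤ s) (hlam : 0 < lam) (c : ℝ) :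
    lam * ((2 * s + lam) / ((s + lam) ^ 2 * s) * c ^ 2)
      = c ^ 2 / s - s / (s + lam) ^ 2 * c ^ 2 := by
  rcases hs.eq_or_lt with rfl | hs
  · simp
  · have h : s + lam ≠ 0 := by positivity
    field_simp
    ring

/-- If `σᵢ ≥ 0`, `Σ_{i : σᵢ > 0} cᵢ²/σᵢ < ∞` and `λ > 0`, then
`|Σᵢ (σᵢ/(σᵢ + λ)²) cᵢ² − Σ_{i : σᵢ > 0} cᵢ²/σᵢ|
   ≤ λ · Σ_{i : σᵢ > 0} ((2σᵢ + λ)/((σᵢ + λ)² σᵢ)) cᵢ²`.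
(With the Lean convention `a / 0 = 0`, terms with `σᵢ = 0` vanish on both sides,
so the full `tsum`s coincide with the sums over `{i : σᵢ > 0}`.) -/
theorem regularized_energy_approximation_error_bound
    (σ c : ℕ → ℝ) (hσ : ∀ i, 0 ≤ σ i)
    (hsum : Summable fun i => c i ^ 2 / σ i) (lam : ℝ) (hlam : 0 < lam) :
    |(∑' i, σ i / (σ i + lam) ^ 2 * c i ^ 2) - ∑' i, c i ^ 2 / σ i|
      ≤ lam * ∑' i, (2 * σ i + lam) / ((σ i + lam) ^ 2 * σ i) * c i ^ 2 := by
  have hdiff := fun i => regularization_filter_identity (hσ i) hlam (c i)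
  have hnonneg : ∀ i, 0 ≤ lam * ((2 * σ i + lam) / ((σ i + lam) ^ 2 * σ i) * c i ^ 2) := by
    intro i
    have := hσ i
    positivity
  have hreg : Summable fun i => σ i / (σ i + lam) ^ 2 * c i ^ 2 := by
    refine hsum.of_nonneg_of_le (fun i => ?_) fun i => ?_
    · have := hσ i
      positivity
    · linarith [hdiff i, hnonneg i]
  have heq : lam * ∑' i, (2 * σ i + lam) / ((σ i + lam) ^ 2 * σ i) * c i ^ 2
      = (∑' i, c i ^ 2 / σ i) - ∑' i, σ i / (σ i + lam) ^ 2 * c i ^ 2 := by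
    rw [← tsum_mul_left, ← hsum.tsum_sub hreg]
    exact tsum_congr hdiff
  have hpos : 0 ≤ lam * ∑' i, (2 * σ i + lam) / ((σ i + lam) ^ 2 * σ i) * c i ^ 2 := by
    rw [← tsum_mul_left]
    exact tsum_nonneg hnonneg
  rw [abs_sub_comm, ← heq, abs_of_nonneg hpos]
end

section
/- Let f : ℝⁿ → ℝⁿ and h : ℝⁿ → ℝ^p be continuous, let x : ℝ → ℝⁿ be differentiable with x'(t) = f(x(t)) for all t, and suppose s ↦ ‖h(x(s))‖² is integrable on [t, ∞) for every t. Let V : ℝⁿ → ℝ be differentiable and suppose V(x(t)) = (1/2) ∫_t^∞ ‖h(x(s))‖² ds for all t ∈ ℝ. Then for every t ∈ ℝ, the derivative of V at x(t) applied to f(x(t)) satisfies DV(x(t))[f(x(t))] + (1/2) ‖h(x(t))‖² = 0. -/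
open MeasureTheory

/-- The tail integral of a continuous function is differentiable in its lower endpoint. -/
theorem hasDerivAt_setIntegral_Ici {g : ℝ → ℝ} (hg : Continuous g)
    (hint : ∀ t : ℝ, IntegrableOn g (Set.Ici t)) (t : ℝ) :
    HasDerivAt (fun u => ∫ s in Set.Ici u, g s) (-g t) t := by
  have hsplit : (fun u => ∫ s in Set.Ici u, g s) =
      fun u => (∫ s in Set.Ioi t, g s) - ∫ s in t..u, g s := by
    funext u
    rw [integral_Ici_eq_integral_Ioi, ← intervalIntegral.integral_Ioi_sub_Ioi'
      ((hint t).mono_set Set.Ioi_subset_Ici_self) ((hint u).mono_set Set.Ioi_subset_Ici_self)]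
    ring
  rw [hsplit]
  exact (hg.integral_hasStrictDerivAt t t).hasDerivAt.const_sub _

/-- If `x` solves `ẋ = f(x)`, `s ↦ ‖h(x(s))‖²` is integrable on
`[t,∞)` for every `t`, and the differentiable function `V` satisfies
`V(x(t)) = (1/2)∫_t^∞ ‖h(x(s))‖² ds` along the trajectory, then
`DV(x(t))[f(x(t))] + (1/2)‖h(x(t))‖² = 0` for every `t`. -/
theorem observability_energy_lyapunov_pde_along_trajectory {n p : ℕ}
    (f : (Fin n → ℝ) → Fin n → ℝ) (h : (Fin n → ℝ) → Fin p → ℝ)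
    (hf : Continuous f) (hh : Continuous h)
    (x : ℝ → Fin n → ℝ) (hx : ∀ t, HasDerivAt x (f (x t)) t)
    (hint : ∀ t : ℝ, IntegrableOn (fun s => ∑ i, h (x s) i ^ 2) (Set.Ici t))
    (V : (Fin n → ℝ) → ℝ) (hV : Differentiable ℝ V)
    (hVeq : ∀ t : ℝ, V (x t) = (1 / 2) * ∫ s in Set.Ici t, ∑ i, h (x s) i ^ 2) :
    ∀ t : ℝ, fderiv ℝ V (x t) (f (x t)) + (1 / 2) * ∑ i, h (x t) i ^ 2 = 0 := by
  intro t
  have hxc : Continuous x := continuous_iff_continuousAt.2 fun s => (hx s).continuousAt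
  have htail : HasDerivAt (V ∘ x) ((1 / 2) * -∑ i, h (x t) i ^ 2) t := by
    rw [show V ∘ x = fun u => (1 / 2) * ∫ s in Set.Ici u, ∑ i, h (x s) i ^ 2 from funext hVeq]
    exact (hasDerivAt_setIntegral_Ici (g := fun s => ∑ i, h (x s) i ^ 2)
      (by fun_prop) hint t).const_mul _
  have hchain := (hV (x t)).hasFDerivAt.comp_hasDerivAt t (hx t)
  rw [hchain.unique htail]
  ring
end
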